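/- Let p be an odd prime and let T^i ⊂ F_p[y_1,y_2] be the span of y_1^{p-1}y_2^i, y_1^{p-2}y_2^{i+1}, …, y_1^i y_2^{p-1}, for 1 ≤ i ≤ p-2, and let S^j denote the homogeneous degree-j polynomials. Then S^{p-1+i} = C S^i + T^i where the multiplication-by-C map sends y_1^a y_2^b to y_1^{a+p-1} y_2^b + contributions determined by C y_j = y_j^p; concretely in the ring R = F_p[y_1,y_2,C]/(Cy_1 - y_1^p, Cy_2 - y_2^p, y_1^p y_2 - y_1 y_2^p, C^2 - y_1^{2p-2} - y_2^{2p-2} + y_1^{p-1}y_2^{p-1}), the degree-(2(p-1+i)) component of the subalgebra generated by y_1, y_2, C equals C·S^i + T^i, and C·S^i is a GL_2(F_p)-submodule with quotient (C S^i + T^i)/C S^i ≅ S^{p-1-i} ⊗ (det)^i. -/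

import Mathlib

open Matrix MvPolynomial

/-- The substitution action of `g ∈ GL₂(F_p)` on `F_p[y₁,y₂]`. -/
noncomputable def subst2 (p : ℕ) (g : GL (Fin 2) (ZMod p)) :
    MvPolynomial (Fin 2) (ZMod p) →ₗ[ZMod p] MvPolynomial (Fin 2) (ZMod p) :=
  (MvPolynomial.aeval fun k : Fin 2 =>
    ∑ l : Fin 2, ((g : Matrix (Fin 2) (Fin 2) (ZMod p)) k l) • (X l :
      MvPolynomial (Fin 2) (ZMod p))).toLinearMap

/-- The substitution action of `g ∈ GL₂(F_p)` on `F_p[y₁,y₂,C]` (`y₁ = X 0`,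
`y₂ = X 1`, `C = X 2`): `g` acts on `y₁, y₂` by linear substitution and fixes `C`. -/
noncomputable def subst3 (p : ℕ) (g : GL (Fin 2) (ZMod p)) :
    MvPolynomial (Fin 3) (ZMod p) →ₗ[ZMod p] MvPolynomial (Fin 3) (ZMod p) :=
  (MvPolynomial.aeval fun k : Fin 3 =>
    if h : (k : ℕ) < 2 then
      ∑ l : Fin 2, ((g : Matrix (Fin 2) (Fin 2) (ZMod p)) ⟨(k : ℕ), h⟩ l) •
        (X (Fin.castSucc l) : MvPolynomial (Fin 3) (ZMod p))
    else (X 2 : MvPolynomial (Fin 3) (ZMod p))).toLinearMap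

lemma sum_zero_aux (p : ℕ) [Fact p.Prime] (A B : ℕ) (h : A < p - 1 ∨ B < p - 1) :
    ∑ s : ZMod p, ∑ t : ZMod p, s ^ A * t ^ B = 0 := by
  simp_rw [← Finset.mul_sum, ← Finset.sum_mul]
  rcases h with h | h
  · rw [FiniteField.sum_pow_lt_card_sub_one (ZMod p) A (by rwa [ZMod.card]), zero_mul]
  · rw [FiniteField.sum_pow_lt_card_sub_one (ZMod p) B (by rwa [ZMod.card]), mul_zero]

lemma sum_pow_top_aux (p : ℕ) [Fact p.Prime] : ∑ s : ZMod p, s ^ (p - 1) = -1 := by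
  have h1 : 0 < p - 1 := by have := (Fact.out : p.Prime).two_le; omega
  have h : ∀ s : ZMod p, s ^ (p - 1) = 1 - if s = 0 then 1 else 0 := by
    intro s
    by_cases hs : s = 0
    · simp [hs, h1.ne']
    · simp [hs, ZMod.pow_card_sub_one_eq_one hs]
  simp [h]

lemma sum_top_aux (p : ℕ) [Fact p.Prime] :
    ∑ s : ZMod p, ∑ t : ZMod p, s ^ (p - 1) * t ^ (p - 1) = 1 := by
  simp_rw [← Finset.mul_sum, ← Finset.sum_mul, sum_pow_top_aux]
  norm_num

/-- The invariant linear form `v ∧ y`. -/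
noncomputable def wedgeForm (p : ℕ) (s t : ZMod p) : MvPolynomial (Fin 2) (ZMod p) :=
  s • X 1 - t • X 0

/-- The intertwiner: sum over all points `(s,t)` of `f(s,t,1) (s y₂ - t y₁)^m`. -/
noncomputable def phiMap (p m : ℕ) [Fact p.Prime] :
    MvPolynomial (Fin 3) (ZMod p) →ₗ[ZMod p] MvPolynomial (Fin 2) (ZMod p) :=
  ∑ s : ZMod p, ∑ t : ZMod p,
    (MvPolynomial.aeval ![s, t, 1] : MvPolynomial (Fin 3) (ZMod p) →ₐ[ZMod p] ZMod p).toLinearMap.smulRight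
      (wedgeForm p s t ^ m)

lemma phiMap_apply (p m : ℕ) [Fact p.Prime] (f : MvPolynomial (Fin 3) (ZMod p)) :
    phiMap p m f = ∑ s : ZMod p, ∑ t : ZMod p,
      (MvPolynomial.aeval ![s, t, 1] f : ZMod p) • wedgeForm p s t ^ m := by
  simp [phiMap, LinearMap.sum_apply]

lemma wedge_pow (p m : ℕ) (s t : ZMod p) :
    wedgeForm p s t ^ m = ∑ k ∈ Finset.range (m + 1),
      (s ^ k * t ^ (m - k)) • (((-1) ^ (m - k) * (m.choose k : ZMod p)) •
        (X 0 ^ (m - k) * X 1 ^ k : MvPolynomial (Fin 2) (ZMod p))) := by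
  rw [wedgeForm, sub_eq_add_neg, add_pow]
  refine Finset.sum_congr rfl fun k _ => ?_
  simp only [MvPolynomial.smul_eq_C_mul, map_mul, map_pow, map_neg, map_one, map_natCast]
  rw [neg_pow]
  ring

lemma phi_monomial (p m a b c : ℕ) [Fact p.Prime] :
    phiMap p m (X 2 ^ c * (X 0 ^ a * X 1 ^ b)) = ∑ k ∈ Finset.range (m + 1),
      (∑ s : ZMod p, ∑ t : ZMod p, s ^ (a + k) * t ^ (b + (m - k))) •
        (((-1) ^ (m - k) * (m.choose k : ZMod p)) •
        (X 0 ^ (m - k) * X 1 ^ k : MvPolynomial (Fin 2) (ZMod p))) := by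
  rw [phiMap_apply]
  simp_rw [wedge_pow, Finset.smul_sum, Finset.sum_smul]
  rw [Finset.sum_comm]
  conv_rhs => rw [Finset.sum_comm]
  rw [Finset.sum_comm]
  refine Finset.sum_congr rfl fun s _ => ?_
  conv_rhs => rw [Finset.sum_comm]
  refine Finset.sum_congr rfl fun t _ => Finset.sum_congr rfl fun k _ => ?_
  rw [smul_smul]
  congr 1
  simp
  ring

lemma phi_C (p i a b : ℕ) [Fact p.Prime] (hi1 : 1 ≤ i) (hi2 : i ≤ p - 2) (hab : a + b = i) :
    phiMap p (p - 1 - i) (X 2 * (X 0 ^ a * X 1 ^ b)) = 0 := by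
  have := phi_monomial p (p - 1 - i) a b 1
  rw [pow_one] at this
  rw [this]
  refine Finset.sum_eq_zero fun k hk => ?_
  rw [Finset.mem_range] at hk
  rw [sum_zero_aux, zero_smul]
  omega

lemma phi_T (p i a b : ℕ) [Fact p.Prime] (hi1 : 1 ≤ i) (hi2 : i ≤ p - 2)
    (hab : a + b = p - 1 + i) (ha : i ≤ a) (ha' : a ≤ p - 1) :
    phiMap p (p - 1 - i) (X 0 ^ a * X 1 ^ b) =
      ((-1) ^ (a - i) * ((p - 1 - i).choose (b - i) : ZMod p)) •
        (X 0 ^ (a - i) * X 1 ^ (b - i) : MvPolynomial (Fin 2) (ZMod p)) := by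
  have := phi_monomial p (p - 1 - i) a b 0
  rw [pow_zero, one_mul] at this
  rw [this, Finset.sum_eq_single (b - i)]
  · have e1 : a + (b - i) = p - 1 := by omega
    have e2 : p - 1 - i - (b - i) = a - i := by omega
    have e3 : b + (a - i) = p - 1 := by omega
    rw [e2, e1, e3, sum_top_aux, one_smul]
  · intro k hk hk'
    rw [Finset.mem_range] at hk
    rw [sum_zero_aux, zero_smul]
    omega
  · intro h
    simp only [Finset.mem_range] at h
    omega

lemma coef_ne_zero (p m j k : ℕ) [Fact p.Prime] (hm : m < p) (hk : k ≤ m) :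
    ((-1) ^ j * (m.choose k : ZMod p)) ≠ 0 := by
  refine mul_ne_zero (pow_ne_zero _ (neg_ne_zero.mpr one_ne_zero)) ?_
  rw [Ne, ZMod.natCast_eq_zero_iff]
  intro h
  have h2 : p ∣ m.factorial := by
    rw [← Nat.choose_mul_factorial_mul_factorial hk, mul_assoc]
    exact Dvd.dvd.mul_right h _
  have := ((Fact.out : p.Prime).dvd_factorial).1 h2
  omega

lemma phi_ideal (p m : ℕ) [Fact p.Prime] (hm : m ≠ 0) (f : MvPolynomial (Fin 3) (ZMod p))
    (hf : f ∈ Ideal.span ({X 0 ^ p * X 1 - X 0 * X 1 ^ p,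
      X 2 * X 0 - X 0 ^ p, X 2 * X 1 - X 1 ^ p,
      X 2 ^ 2 - X 0 ^ (2 * p - 2) - X 1 ^ (2 * p - 2) + X 0 ^ (p - 1) * X 1 ^ (p - 1)} :
      Set (MvPolynomial (Fin 3) (ZMod p)))) : phiMap p m f = 0 := by
  rw [phiMap_apply]
  refine Finset.sum_eq_zero fun s _ => Finset.sum_eq_zero fun t _ => ?_
  by_cases hst : s = 0 ∧ t = 0
  · simp [wedgeForm, hst.1, hst.2, hm]
  suffices h : f ∈ RingHom.ker (MvPolynomial.aeval ![s, t, 1] :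
      MvPolynomial (Fin 3) (ZMod p) →ₐ[ZMod p] ZMod p) by
    rw [(RingHom.mem_ker).1 h, zero_smul]
  revert hf
  revert f
  change Ideal.span _ ≤ _
  rw [Ideal.span_le]
  have h1 : p - 1 ≠ 0 := by have := (Fact.out : p.Prime).two_le; omega
  have h2 : 2 * p - 2 = (p - 1) * 2 := by omega
  rintro x (rfl | rfl | rfl | rfl)
  · simp [RingHom.mem_ker]
  · simp [RingHom.mem_ker]
  · simp [RingHom.mem_ker]
  · simp only [SetLike.mem_coe, RingHom.mem_ker, h2, pow_mul]
    by_cases hs : s = 0 <;> by_cases ht : t = 0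
    · exact absurd ⟨hs, ht⟩ hst
    · simp [hs, h1, ZMod.pow_card_sub_one_eq_one ht]
    · simp [ht, h1, ZMod.pow_card_sub_one_eq_one hs]
    · simp [ZMod.pow_card_sub_one_eq_one ht, ZMod.pow_card_sub_one_eq_one hs]

lemma eval_subst3 (p : ℕ) (g : GL (Fin 2) (ZMod p)) (s t : ZMod p)
    (f : MvPolynomial (Fin 3) (ZMod p)) :
    (MvPolynomial.aeval ![s, t, 1] (subst3 p g f) : ZMod p) =
      MvPolynomial.aeval ![g 0 0 * s + g 0 1 * t, g 1 0 * s + g 1 1 * t, 1] f := by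
  rw [subst3, AlgHom.toLinearMap_apply, ← AlgHom.comp_apply]
  congr 1
  refine MvPolynomial.algHom_ext fun k => ?_
  fin_cases k <;> simp [Fin.sum_univ_two]

lemma subst2_wedge (p m : ℕ) (g : GL (Fin 2) (ZMod p)) (s t : ZMod p) :
    subst2 p g (wedgeForm p (g 0 0 * s + g 0 1 * t) (g 1 0 * s + g 1 1 * t) ^ m) =
      ((g : Matrix (Fin 2) (Fin 2) (ZMod p)).det ^ m) • wedgeForm p s t ^ m := by
  rw [subst2, AlgHom.toLinearMap_apply, map_pow, ← smul_pow]
  congr 1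
  simp only [wedgeForm, map_sub, map_smul, aeval_X, Fin.sum_univ_two, Matrix.det_fin_two]
  simp only [MvPolynomial.smul_eq_C_mul, map_add, map_sub, map_mul]
  ring

/-- The linear change of points on `F_p × F_p`. -/
lemma sum_change (p : ℕ) [Fact p.Prime] (g : GL (Fin 2) (ZMod p))
    {M : Type*} [AddCommMonoid M] (F : ZMod p → ZMod p → M) :
    ∑ s : ZMod p, ∑ t : ZMod p, F (g 0 0 * s + g 0 1 * t) (g 1 0 * s + g 1 1 * t) =
      ∑ s : ZMod p, ∑ t : ZMod p, F s t := by
  rw [← Fintype.sum_prod_type', ← Fintype.sum_prod_type']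
  have hinj : Function.Injective (fun x : ZMod p × ZMod p =>
      (g 0 0 * x.1 + g 0 1 * x.2, g 1 0 * x.1 + g 1 1 * x.2)) := by
    have hd : (g : Matrix (Fin 2) (Fin 2) (ZMod p)).det ≠ 0 := by
      exact ((Matrix.isUnit_iff_isUnit_det _).1 g.isUnit).ne_zero
    rw [Matrix.det_fin_two] at hd
    rintro ⟨a, b⟩ ⟨c, d⟩ h
    simp only [Prod.mk.injEq] at h
    obtain ⟨h1, h2⟩ := h
    ext
    · apply mul_left_cancel₀ hd
      linear_combination g 1 1 * h1 - g 0 1 * h2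
    · apply mul_left_cancel₀ hd
      linear_combination g 0 0 * h2 - g 1 0 * h1
  exact Fintype.sum_bijective _ (Finite.injective_iff_bijective.1 hinj) _ _ (fun _ => rfl)

lemma phi_equivariant (p i : ℕ) [Fact p.Prime] (hi2 : i ≤ p - 2)
    (g : GL (Fin 2) (ZMod p)) (f : MvPolynomial (Fin 3) (ZMod p)) :
    phiMap p (p - 1 - i) (subst3 p g f) =
      ((g : Matrix (Fin 2) (Fin 2) (ZMod p)).det ^ i) • subst2 p g (phiMap p (p - 1 - i) f) := by
  have hd : (g : Matrix (Fin 2) (Fin 2) (ZMod p)).det ≠ 0 :=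
    ((Matrix.isUnit_iff_isUnit_det _).1 g.isUnit).ne_zero
  have hp2 := (Fact.out : p.Prime).two_le
  rw [phiMap_apply, phiMap_apply, ← sum_change p g (fun s t =>
    (MvPolynomial.aeval ![s, t, 1] f : ZMod p) • wedgeForm p s t ^ (p - 1 - i)),
    map_sum, Finset.smul_sum]
  refine Finset.sum_congr rfl fun s _ => ?_
  rw [map_sum, Finset.smul_sum]
  refine Finset.sum_congr rfl fun t _ => ?_
  rw [map_smul, subst2_wedge, eval_subst3, smul_comm, smul_smul _ _ (wedgeForm p s t ^ _),
    ← pow_add, show i + (p - 1 - i) = p - 1 by omega, ZMod.pow_card_sub_one_eq_one hd, one_smul]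

lemma lin_mul_mem (p : ℕ) (q : MvPolynomial (Fin 3) (ZMod p)) (n : ℕ) (c d : ZMod p)
    (f : MvPolynomial (Fin 3) (ZMod p))
    (hf : q * f ∈ Submodule.span (ZMod p)
      {f | ∃ a b : ℕ, a + b = n ∧ f = q * (X 0 ^ a * X 1 ^ b)}) :
    q * ((c • X 0 + d • X 1) * f) ∈ Submodule.span (ZMod p)
      {f | ∃ a b : ℕ, a + b = n + 1 ∧ f = q * (X 0 ^ a * X 1 ^ b)} := by
  rw [mul_left_comm]
  generalize q * f = h at hf
  induction hf using Submodule.span_induction with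
  | mem x hx =>
    obtain ⟨a, b, hab, rfl⟩ := hx
    have : (c • X 0 + d • X 1) * (q * (X 0 ^ a * X 1 ^ b)) =
      c • (q * (X 0 ^ (a + 1) * X 1 ^ b)) + d • (q * (X 0 ^ a * X 1 ^ (b + 1))) := by
      simp only [MvPolynomial.smul_eq_C_mul]
      ring
    rw [this]
    exact Submodule.add_mem _
      (Submodule.smul_mem _ _ (Submodule.subset_span ⟨a + 1, b, by omega, rfl⟩))
      (Submodule.smul_mem _ _ (Submodule.subset_span ⟨a, b + 1, by omega, rfl⟩))
  | zero => simp
  | add x y _ _ hx hy => rw [mul_add]; exact Submodule.add_mem _ hx hy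
  | smul r x _ hx => rw [mul_smul_comm]; exact Submodule.smul_mem _ _ hx

lemma lin_pow_mem (p : ℕ) (q : MvPolynomial (Fin 3) (ZMod p)) (a b : ℕ) (c d c' d' : ZMod p) :
    q * ((c • X 0 + d • X 1) ^ a * (c' • X 0 + d' • X 1) ^ b) ∈ Submodule.span (ZMod p)
      {f | ∃ u v : ℕ, u + v = a + b ∧ f = q * (X 0 ^ u * X 1 ^ v)} := by
  induction a with
  | zero =>
    induction b with
    | zero => exact Submodule.subset_span ⟨0, 0, rfl, by simp⟩
    | succ b ih =>
      have := lin_mul_mem p q _ c' d' _ ih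
      rw [← add_assoc]
      rw [pow_succ' _ b, mul_left_comm (_ ^ 0)]
      exact this
  | succ a ih =>
    have := lin_mul_mem p q _ c d _ ih
    rw [show a + 1 + b = a + b + 1 by omega]
    rw [pow_succ' _ a, mul_assoc (_ + _)]
    exact this

lemma phi_homog (p m : ℕ) [Fact p.Prime] (f : MvPolynomial (Fin 3) (ZMod p)) :
    phiMap p m f ∈ homogeneousSubmodule (Fin 2) (ZMod p) m := by
  rw [phiMap_apply]
  refine Submodule.sum_mem _ fun s _ => Submodule.sum_mem _ fun t _ => Submodule.smul_mem _ _ ?_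
  rw [mem_homogeneousSubmodule]
  have : (wedgeForm p s t).IsHomogeneous 1 := by
    rw [← mem_homogeneousSubmodule, wedgeForm]
    exact Submodule.sub_mem _ (Submodule.smul_mem _ _ (isHomogeneous_X _ _))
      (Submodule.smul_mem _ _ (isHomogeneous_X _ _))
  simpa using this.pow m

lemma monomial_fin2 (p : ℕ) (d : Fin 2 →₀ ℕ) :
    (monomial d 1 : MvPolynomial (Fin 2) (ZMod p)) = X 0 ^ d 0 * X 1 ^ d 1 := by
  rw [monomial_eq, Finsupp.prod_fintype _ _ (by simp)]
  simp [Fin.sum_univ_two]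

/-- Left inverse of `phiMap` on `T^i`. -/
noncomputable def psiMap (p i : ℕ) :
    MvPolynomial (Fin 2) (ZMod p) →ₗ[ZMod p] MvPolynomial (Fin 3) (ZMod p) :=
  (basisMonomials (Fin 2) (ZMod p)).constr (ZMod p) fun d =>
    ((-1) ^ (d 0) * ((p - 1 - i).choose (d 1) : ZMod p))⁻¹ • (X 0 ^ (d 0 + i) * X 1 ^ (d 1 + i))

lemma psi_apply (p i a b : ℕ) :
    psiMap p i (X 0 ^ a * X 1 ^ b) =
     ((-1) ^ a * ((p - 1 - i).choose b : ZMod p))⁻¹ • (X 0 ^ (a + i) * X 1 ^ (b + i)) := by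
  have h := (basisMonomials (Fin 2) (ZMod p)).constr_basis (ZMod p) (fun d =>
    ((-1) ^ (d 0) * ((p - 1 - i).choose (d 1) : ZMod p))⁻¹ •
      (X 0 ^ (d 0 + i) * X 1 ^ (d 1 + i) : MvPolynomial (Fin 3) (ZMod p)))
      (Finsupp.single 0 a + Finsupp.single 1 b)
  rw [coe_basisMonomials] at h
  beta_reduce at h
  rw [monomial_fin2] at h
  simpa [psiMap] using h

/-- In `R = F_p[y₁,y₂,C]/(relations)`: the image of `S^(p-1+i)` equals the image
of `C·S^i + T^i`; `C·S^i` is a `GL₂(F_p)`-submodule; and the quotient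
`(C S^i + T^i)/C S^i` is isomorphic to `S^(p-1-i) ⊗ det^i`, the isomorphism being
encoded by a linear map `φ` on representatives whose kernel on the relevant
subspace is exactly (the preimage of) `C·S^i` and which intertwines the action of
`GL₂(F_p)` with the `det^i`-twisted substitution action on `S^(p-1-i)`. -/
theorem stmt10 (p i : ℕ) (hp : p.Prime) (hodd : Odd p)
    (hi1 : 1 ≤ i) (hi2 : i ≤ p - 2)
    (I : Ideal (MvPolynomial (Fin 3) (ZMod p)))
    (hI : I = Ideal.span {X 0 ^ p * X 1 - X 0 * X 1 ^ p,
      X 2 * X 0 - X 0 ^ p, X 2 * X 1 - X 1 ^ p,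
      X 2 ^ 2 - X 0 ^ (2 * p - 2) - X 1 ^ (2 * p - 2) + X 0 ^ (p - 1) * X 1 ^ (p - 1)})
    (Sbig CSi Ti : Submodule (ZMod p) (MvPolynomial (Fin 3) (ZMod p)))
    (hS : Sbig = Submodule.span (ZMod p)
      {f | ∃ a b : ℕ, a + b = p - 1 + i ∧ f = X 0 ^ a * X 1 ^ b})
    (hCS : CSi = Submodule.span (ZMod p)
      {f | ∃ a b : ℕ, a + b = i ∧ f = X 2 * (X 0 ^ a * X 1 ^ b)})
    (hT : Ti = Submodule.span (ZMod p)
      {f | ∃ a b : ℕ, a + b = p - 1 + i ∧ i ≤ a ∧ a ≤ p - 1 ∧ f = X 0 ^ a * X 1 ^ b}) :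
    Submodule.map (Ideal.Quotient.mkₐ (ZMod p) I).toLinearMap Sbig =
      Submodule.map (Ideal.Quotient.mkₐ (ZMod p) I).toLinearMap (CSi ⊔ Ti) ∧
    (∀ g : GL (Fin 2) (ZMod p), ∀ f ∈ CSi,
      (Ideal.Quotient.mkₐ (ZMod p) I).toLinearMap (subst3 p g f) ∈
        Submodule.map (Ideal.Quotient.mkₐ (ZMod p) I).toLinearMap CSi) ∧
    (∃ φ : MvPolynomial (Fin 3) (ZMod p) →ₗ[ZMod p] MvPolynomial (Fin 2) (ZMod p),
      Submodule.map φ (Sbig ⊔ CSi) =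
        homogeneousSubmodule (Fin 2) (ZMod p) (p - 1 - i) ∧
      (∀ f ∈ Sbig ⊔ CSi,
        (φ f = 0 ↔ (Ideal.Quotient.mkₐ (ZMod p) I).toLinearMap f ∈
          Submodule.map (Ideal.Quotient.mkₐ (ZMod p) I).toLinearMap CSi)) ∧
      (∀ g : GL (Fin 2) (ZMod p), ∀ f ∈ Sbig ⊔ CSi,
        φ (subst3 p g f) =
          ((g : Matrix (Fin 2) (Fin 2) (ZMod p)).det ^ i) • subst2 p g (φ f))) := by
  haveI : Fact p.Prime := ⟨hp⟩
  have hp2 := hp.two_le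
  have hp3 : 3 ≤ p := by omega
  have hlift : ∀ (x y : MvPolynomial (Fin 3) (ZMod p)), x - y ∈ I →
      (Ideal.Quotient.mkₐ (ZMod p) I).toLinearMap x =
        (Ideal.Quotient.mkₐ (ZMod p) I).toLinearMap y := fun x y h => by
    simpa using Ideal.Quotient.eq.2 h
  have hr0 : ∀ a b : ℕ, X 2 * (X 0 ^ (a + 1) * X 1 ^ b) - X 0 ^ (a + p) * X 1 ^ b ∈ I := by
    intro a b
    have h : (X 2 * X 0 - X 0 ^ p : MvPolynomial (Fin 3) (ZMod p)) ∈ I := by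
      rw [hI]; exact Ideal.subset_span (by simp)
    convert I.mul_mem_left (X 0 ^ a * X 1 ^ b) h using 1
    ring
  have hr1 : ∀ a b : ℕ, X 2 * (X 0 ^ a * X 1 ^ (b + 1)) - X 0 ^ a * X 1 ^ (b + p) ∈ I := by
    intro a b
    have h : (X 2 * X 1 - X 1 ^ p : MvPolynomial (Fin 3) (ZMod p)) ∈ I := by
      rw [hI]; exact Ideal.subset_span (by simp)
    convert I.mul_mem_left (X 0 ^ a * X 1 ^ b) h using 1
    ring
  have hTS : Ti ≤ Sbig := by
    rw [hT, hS]
    apply Submodule.span_mono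
    rintro f ⟨a, b, hab, -, -, rfl⟩
    exact ⟨a, b, hab, rfl⟩
  have hCSmap : Submodule.map (Ideal.Quotient.mkₐ (ZMod p) I).toLinearMap CSi ≤
      Submodule.map (Ideal.Quotient.mkₐ (ZMod p) I).toLinearMap Sbig := by
    rw [Submodule.map_le_iff_le_comap, hCS, Submodule.span_le]
    rintro f ⟨a, b, hab, rfl⟩
    rcases a with _ | a
    · obtain ⟨b, rfl⟩ : ∃ n, b = n + 1 := ⟨b - 1, by omega⟩
      refine ⟨X 0 ^ 0 * X 1 ^ (b + p), ?_, (hlift _ _ (hr1 0 b)).symm⟩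
      rw [hS]
      exact Submodule.subset_span ⟨0, b + p, by omega, rfl⟩
    · refine ⟨X 0 ^ (a + p) * X 1 ^ b, ?_, (hlift _ _ (hr0 a b)).symm⟩
      rw [hS]
      exact Submodule.subset_span ⟨a + p, b, by omega, rfl⟩
  have part1 : Submodule.map (Ideal.Quotient.mkₐ (ZMod p) I).toLinearMap Sbig =
      Submodule.map (Ideal.Quotient.mkₐ (ZMod p) I).toLinearMap (CSi ⊔ Ti) := by
    apply le_antisymm
    · rw [Submodule.map_le_iff_le_comap]
      nth_rewrite 1 [hS]
      rw [Submodule.span_le]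
      rintro f ⟨a, b, hab, rfl⟩
      by_cases h1 : a < i
      · obtain ⟨b, rfl⟩ : ∃ n, b = n + p := ⟨b - p, by omega⟩
        refine ⟨X 2 * (X 0 ^ a * X 1 ^ (b + 1)), ?_, hlift _ _ (hr1 a b)⟩
        apply Submodule.mem_sup_left
        rw [hCS]
        exact Submodule.subset_span ⟨a, b + 1, by omega, rfl⟩
      by_cases h2 : a ≤ p - 1
      · refine ⟨_, ?_, rfl⟩
        apply Submodule.mem_sup_right
        rw [hT]
        exact Submodule.subset_span ⟨a, b, hab, by omega, h2, rfl⟩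
      · obtain ⟨a, rfl⟩ : ∃ n, a = n + p := ⟨a - p, by omega⟩
        refine ⟨X 2 * (X 0 ^ (a + 1) * X 1 ^ b), ?_, hlift _ _ (hr0 a b)⟩
        apply Submodule.mem_sup_left
        rw [hCS]
        exact Submodule.subset_span ⟨a + 1, b, by omega, rfl⟩
    · rw [Submodule.map_sup]
      exact sup_le hCSmap (Submodule.map_mono hTS)
  have hphiC : ∀ f ∈ CSi, phiMap p (p - 1 - i) f = 0 := by
    intro f hf
    have : CSi ≤ LinearMap.ker (phiMap p (p - 1 - i)) := by
      rw [hCS, Submodule.span_le]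
      rintro f ⟨a, b, hab, rfl⟩
      exact phi_C p i a b hi1 hi2 hab
    exact this hf
  have hphiI : ∀ f ∈ I, phiMap p (p - 1 - i) f = 0 := by
    intro f hf
    rw [hI] at hf
    exact phi_ideal p _ (by omega) f hf
  have hpsi : ∀ f ∈ Ti, psiMap p i (phiMap p (p - 1 - i) f) = f := by
    intro f hf
    rw [hT] at hf
    induction hf using Submodule.span_induction with
    | mem x hx =>
      obtain ⟨a, b, hab, h1, h2, rfl⟩ := hx
      rw [phi_T p i a b hi1 hi2 hab h1 h2, map_smul, psi_apply, smul_smul,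
        mul_inv_cancel₀ (coef_ne_zero p _ _ _ (by omega) (by omega)), one_smul,
        Nat.sub_add_cancel h1, Nat.sub_add_cancel (by omega)]
    | zero => simp
    | add x y _ _ hx hy => rw [map_add, map_add, hx, hy]
    | smul r x _ hx => rw [map_smul, map_smul, hx]
  refine ⟨part1, ?_, phiMap p (p - 1 - i), ?_, ?_, ?_⟩
  · intro g f hf
    refine Submodule.mem_map_of_mem ?_
    have : CSi ≤ CSi.comap (subst3 p g) := by
      nth_rewrite 1 [hCS]
      rw [Submodule.span_le]
      rintro f ⟨a, b, hab, rfl⟩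
      have h := lin_pow_mem p (X 2) a b (g 0 0) (g 0 1) (g 1 0) (g 1 1)
      rw [hab, ← hCS] at h
      simpa [subst3, Fin.sum_univ_two] using h
    exact this hf
  · apply le_antisymm
    · rintro _ ⟨f, -, rfl⟩
      exact phi_homog p _ f
    · intro f hf
      rw [f.as_sum]
      refine Submodule.sum_mem _ fun d hd => ?_
      have hdeg : d 0 + d 1 = p - 1 - i := by
        have := hf (mem_support_iff.1 hd)
        simpa [Finsupp.weight_apply, Finsupp.sum_fintype, Fin.sum_univ_two] using this
      have hT' := phi_T p i (d 0 + i) (d 1 + i) hi1 hi2 (by omega) (by omega) (by omega)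
      rw [Nat.add_sub_cancel, Nat.add_sub_cancel, ← monomial_fin2] at hT'
      have hc := coef_ne_zero p (p - 1 - i) (d 0) (d 1) (by omega) (by omega)
      rw [← mul_one (coeff d f), ← smul_eq_mul, ← smul_monomial]
      refine Submodule.smul_mem _ _ ?_
      rw [← Submodule.smul_mem_iff _ hc, ← hT']
      refine Submodule.mem_map_of_mem (Submodule.mem_sup_left ?_)
      rw [hS]
      exact Submodule.subset_span ⟨_, _, by omega, rfl⟩
  · intro f hf
    constructor
    · intro h0
      have h1 : (Ideal.Quotient.mkₐ (ZMod p) I).toLinearMap f ∈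
          Submodule.map (Ideal.Quotient.mkₐ (ZMod p) I).toLinearMap (CSi ⊔ Ti) := by
        have h2 := Submodule.mem_map_of_mem (f := (Ideal.Quotient.mkₐ (ZMod p) I).toLinearMap) hf
        rw [Submodule.map_sup, sup_eq_left.2 hCSmap, part1] at h2
        exact h2
      obtain ⟨x, hx, hxf⟩ := h1
      obtain ⟨c, hc, t, ht, rfl⟩ := Submodule.mem_sup.1 hx
      have h3 : c + t - f ∈ I := Ideal.Quotient.eq.1 (by simpa using hxf)
      have h4 := hphiI _ h3
      rw [map_sub, map_add, h0, hphiC c hc, zero_add, sub_zero] at h4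
      have h5 := hpsi t ht
      rw [h4, map_zero] at h5
      rw [← hxf, ← h5, add_zero]
      exact Submodule.mem_map_of_mem hc
    · rintro ⟨c, hc, hcf⟩
      have h3 : c - f ∈ I := Ideal.Quotient.eq.1 (by simpa using hcf)
      have h4 := hphiI _ h3
      rw [map_sub, hphiC c hc, zero_sub, neg_eq_zero] at h4
      exact h4
  · intro g f _
    exact phi_equivariant p i hi2 g f
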